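/- arXiv:1410.7907 — 2 statements merged into one kernel-verified Lean document; each statement's English description precedes it below -/
import Mathlib

section
/- Suppose f(u) = a u + a₁ and g(u) = b u + b₁ with constants a, a₁, b, b₁ satisfying a² + b² = 1, a ≠ 0, b ≠ 0, and the spherical curvature κ is a constant κ₀. Then ΔG = ((1 + κ₀²)/f²)(G + C), where C = −(a/(1 + κ₀²))(a x∧y + κ₀ y∧n₁ + b y∧n₂) is a nonzero bivector that is constant in (u,v). In particular M² has pointwise 1-type Gauss map of the second kind. -/
open Matrix

noncomputable section

/-- The embedding of `ℝ³ = span{e₁,e₂,e₃}` into `ℝ⁴`. -/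
def emb (p : Fin 3 → ℝ) : Fin 4 → ℝ := ![p 0, p 1, p 2, 0]

/-- The fourth standard basis vector `e₄` of `ℝ⁴`. -/
def e4 : Fin 4 → ℝ := ![0, 0, 0, 1]

/-- Model of the bivector `a ∧ b ∈ Λ²ℝ⁴` as the antisymmetric matrix `aᵢbⱼ − aⱼbᵢ`. -/
def wedge (a b : Fin 4 → ℝ) : Fin 4 → Fin 4 → ℝ := fun i j => a i * b j - a j * b i

/-- The tangent `t = r'` of the spherical curve `r`. -/
def sphT (r : ℝ → Fin 3 → ℝ) : ℝ → Fin 3 → ℝ := deriv r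

/-- The normal `n = r × t` of the spherical curve `r`. -/
def sphN (r : ℝ → Fin 3 → ℝ) (v : ℝ) : Fin 3 → ℝ := crossProduct (r v) (deriv r v)

/-- The spherical curvature `κ = ⟨t', n⟩` of the spherical curve `r`. -/
def sphCurv (r : ℝ → Fin 3 → ℝ) (v : ℝ) : ℝ := deriv (deriv r) v ⬝ᵥ sphN r v

/-- The curvature `κ_α = f′g″ − g′f″` of the meridian curve `α = (f, g)`. -/
def merCurv (f g : ℝ → ℝ) (u : ℝ) : ℝ :=
  deriv f u * deriv (deriv g) u - deriv g u * deriv (deriv f) u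

/-- The parametrization `z(u,v) = f(u) r(v) + g(u) e₄` of the meridian surface `M²`. -/
def mz (f g : ℝ → ℝ) (r : ℝ → Fin 3 → ℝ) (u v : ℝ) : Fin 4 → ℝ :=
  f u • emb (r v) + g u • e4

/-- The tangent frame vector `x = ∂z/∂u = f′ r + g′ e₄`. -/
def mx (f g : ℝ → ℝ) (r : ℝ → Fin 3 → ℝ) (u v : ℝ) : Fin 4 → ℝ :=
  deriv f u • emb (r v) + deriv g u • e4

/-- The tangent frame vector `y = (1/f) ∂z/∂v = t`. -/
def my (r : ℝ → Fin 3 → ℝ) (v : ℝ) : Fin 4 → ℝ := emb (deriv r v)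

/-- The normal frame vector `n₁ = n`. -/
def mn1 (r : ℝ → Fin 3 → ℝ) (v : ℝ) : Fin 4 → ℝ := emb (sphN r v)

/-- The normal frame vector `n₂ = −g′ r + f′ e₄`. -/
def mn2 (f g : ℝ → ℝ) (r : ℝ → Fin 3 → ℝ) (u v : ℝ) : Fin 4 → ℝ :=
  (-(deriv g u)) • emb (r v) + deriv f u • e4

/-- The Gauss map `G = x ∧ y` of the meridian surface, with values in `Λ²ℝ⁴`. -/
def gaussG (f g : ℝ → ℝ) (r : ℝ → Fin 3 → ℝ) (u v : ℝ) : Fin 4 → Fin 4 → ℝ :=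
  wedge (mx f g r u v) (my r v)

/-- The Laplacian `Δφ = −(∂²φ/∂u² + (1/f²) ∂²φ/∂v² + (f′/f) ∂φ/∂u)` of the meridian
surface, acting on `Λ²ℝ⁴`-valued functions. -/
def surfLap (f : ℝ → ℝ) (φ : ℝ → ℝ → Fin 4 → Fin 4 → ℝ) (u v : ℝ) : Fin 4 → Fin 4 → ℝ :=
  -(deriv (deriv (fun s => φ s v)) u + (1 / f u ^ 2) • deriv (deriv (fun s => φ u s)) v
    + (deriv f u / f u) • deriv (fun s => φ s v) u)

/-- `h(x,x)`: the normal component (w.r.t. `{n₁, n₂}`) of `∇′ₓx = ∂x/∂u`. -/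
def hxx (f g : ℝ → ℝ) (r : ℝ → Fin 3 → ℝ) (u v : ℝ) : Fin 4 → ℝ :=
  (deriv (fun s => mx f g r s v) u ⬝ᵥ mn1 r v) • mn1 r v
    + (deriv (fun s => mx f g r s v) u ⬝ᵥ mn2 f g r u v) • mn2 f g r u v

/-- `h(x,y)`: the normal component (w.r.t. `{n₁, n₂}`) of `∇′_y x = (1/f) ∂x/∂v`. -/
def hxy (f g : ℝ → ℝ) (r : ℝ → Fin 3 → ℝ) (u v : ℝ) : Fin 4 → ℝ :=
  (((1 / f u) • deriv (fun s => mx f g r u s) v) ⬝ᵥ mn1 r v) • mn1 r v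
    + (((1 / f u) • deriv (fun s => mx f g r u s) v) ⬝ᵥ mn2 f g r u v) • mn2 f g r u v

/-- `h(y,y)`: the normal component (w.r.t. `{n₁, n₂}`) of `∇′_y y = (1/f) ∂y/∂v`. -/
def hyy (f g : ℝ → ℝ) (r : ℝ → Fin 3 → ℝ) (u v : ℝ) : Fin 4 → ℝ :=
  (((1 / f u) • deriv (my r) v) ⬝ᵥ mn1 r v) • mn1 r v
    + (((1 / f u) • deriv (my r) v) ⬝ᵥ mn2 f g r u v) • mn2 f g r u v


/-- The constant bivector `C = −(a/(1+κ₀²))(a x∧y + κ₀ y∧n₁ + b y∧n₂)` of Statement 15. -/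
def C15 (f g : ℝ → ℝ) (r : ℝ → Fin 3 → ℝ) (a b κ₀ : ℝ) (u v : ℝ) : Fin 4 → Fin 4 → ℝ :=
  (-(a / (1 + κ₀ ^ 2))) •
    (a • wedge (mx f g r u v) (my r v) + κ₀ • wedge (my r v) (mn1 r v)
      + b • wedge (my r v) (mn2 f g r u v))

/-- A vector of `ℝ³` expanded in the orthonormal frame `r, t, r × t`. -/
lemma eq_neg_add_smul_cross {r t s : Fin 3 → ℝ} {κ : ℝ} (hrr : r ⬝ᵥ r = 1) (htt : t ⬝ᵥ t = 1)
    (hrt : r ⬝ᵥ t = 0) (hrs : r ⬝ᵥ s = -1) (hts : t ⬝ᵥ s = 0)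
    (hns : s ⬝ᵥ crossProduct r t = κ) : s = -r + κ • crossProduct r t := by
  have expand : ∀ p q w : Fin 3 → ℝ,
      (crossProduct p q ⬝ᵥ crossProduct p q) • w
        = (p ⬝ᵥ w) • crossProduct q (crossProduct p q)
          + (q ⬝ᵥ w) • crossProduct (crossProduct p q) p
          + (w ⬝ᵥ crossProduct p q) • crossProduct p q := by
    intro p q w
    ext i
    fin_cases i <;> simp [cross_apply, dotProduct, Fin.sum_univ_three] <;> ring
  have hnn : crossProduct r t ⬝ᵥ crossProduct r t = 1 := by
    rw [cross_dot_cross, hrr, htt, hrt, dotProduct_comm t r, hrt]; ring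
  have htn : crossProduct t (crossProduct r t) = r := by
    have h : crossProduct t (crossProduct r t) = (t ⬝ᵥ t) • r - (r ⬝ᵥ t) • t := by
      ext i
      fin_cases i <;> simp [cross_apply, dotProduct, Fin.sum_univ_three] <;> ring
    rw [h, htt, hrt]; simp
  have h := expand r t s
  rw [hnn, hrs, hts, hns, htn] at h
  simpa using h

lemma HasDerivAt.dotProduct {n : ℕ} {p q : ℝ → Fin n → ℝ} {p' q' : Fin n → ℝ} {v : ℝ}
    (hp : HasDerivAt p p' v) (hq : HasDerivAt q q' v) :
    HasDerivAt (fun s => p s ⬝ᵥ q s) (p' ⬝ᵥ q v + p v ⬝ᵥ q') v := by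
  rw [hasDerivAt_pi] at hp hq
  have h := HasDerivAt.fun_sum (u := Finset.univ) fun i _ => (hp i).mul (hq i)
  rw [Finset.sum_add_distrib] at h
  exact h

lemma HasDerivAt.crossProduct {p q : ℝ → Fin 3 → ℝ} {p' q' : Fin 3 → ℝ} {v : ℝ}
    (hp : HasDerivAt p p' v) (hq : HasDerivAt q q' v) :
    HasDerivAt (fun s => crossProduct (p s) (q s))
      (_root_.crossProduct p' (q v) + _root_.crossProduct (p v) q') v := by
  rw [hasDerivAt_pi] at hp hq ⊢
  intro i
  fin_cases i
  · refine (((hp 1).fun_mul (hq 2)).fun_sub ((hp 2).fun_mul (hq 1))).congr_deriv ?_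
    simp [cross_apply]; ring
  · refine (((hp 2).fun_mul (hq 0)).fun_sub ((hp 0).fun_mul (hq 2))).congr_deriv ?_
    simp [cross_apply]; ring
  · refine (((hp 0).fun_mul (hq 1)).fun_sub ((hp 1).fun_mul (hq 0))).congr_deriv ?_
    simp [cross_apply]; ring

lemma HasDerivAt.emb {p : ℝ → Fin 3 → ℝ} {p' : Fin 3 → ℝ} {v : ℝ} (hp : HasDerivAt p p' v) :
    HasDerivAt (fun s => emb (p s)) (_root_.emb p') v := by
  rw [hasDerivAt_pi] at hp ⊢
  intro i
  fin_cases i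
  · exact hp 0
  · exact hp 1
  · exact hp 2
  · exact hasDerivAt_const v (0 : ℝ)

lemma HasDerivAt.wedge {p q : ℝ → Fin 4 → ℝ} {p' q' : Fin 4 → ℝ} {v : ℝ}
    (hp : HasDerivAt p p' v) (hq : HasDerivAt q q' v) :
    HasDerivAt (fun s => wedge (p s) (q s)) (_root_.wedge p' (q v) + _root_.wedge (p v) q') v := by
  rw [hasDerivAt_pi] at hp hq
  refine hasDerivAt_pi.2 fun i => hasDerivAt_pi.2 fun j => ?_
  refine (((hp i).fun_mul (hq j)).fun_sub ((hp j).fun_mul (hq i))).congr_deriv ?_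
  simp only [_root_.wedge, Pi.add_apply]; ring

lemma emb_add (p q : Fin 3 → ℝ) : emb (p + q) = emb p + emb q := by
  ext i; fin_cases i <;> simp [emb]

lemma emb_smul (c : ℝ) (p : Fin 3 → ℝ) : emb (c • p) = c • emb p := by
  ext i; fin_cases i <;> simp [emb]

lemma emb_neg (p : Fin 3 → ℝ) : emb (-p) = -emb p := by
  ext i; fin_cases i <;> simp [emb]

section SphericalCurve

variable {J : Set ℝ} {r : ℝ → Fin 3 → ℝ}

lemma hasDerivAt_deriv_of_contDiffOn (hJ : IsOpen J) (hr : ContDiffOn ℝ (⊤ : ℕ∞) r J)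
    {v : ℝ} (hv : v ∈ J) :
    HasDerivAt r (deriv r v) v ∧ HasDerivAt (deriv r) (deriv (deriv r) v) v := by
  have h1 : ContDiffOn ℝ 1 (deriv r) J :=
    hr.deriv_of_isOpen hJ (by
      rw [one_add_one_eq_two]
      exact WithTop.coe_le_coe.2 (le_top : (2 : ℕ∞) ≤ ⊤))
  exact ⟨((hr.differentiableOn (by simp)).differentiableAt (hJ.mem_nhds hv)).hasDerivAt,
    ((h1.differentiableOn one_ne_zero).differentiableAt (hJ.mem_nhds hv)).hasDerivAt⟩

lemma dotProduct_deriv_of_unit (hJ : IsOpen J) {p : ℝ → Fin 3 → ℝ} {p' : Fin 3 → ℝ}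
    (h : ∀ v ∈ J, p v ⬝ᵥ p v = 1) {v : ℝ} (hv : v ∈ J) (hp : HasDerivAt p p' v) :
    p v ⬝ᵥ p' = 0 := by
  have h1 : HasDerivAt (fun s => p s ⬝ᵥ p s) 0 v :=
    (hasDerivAt_const v (1 : ℝ)).congr_of_eventuallyEq
      (Filter.eventually_of_mem (hJ.mem_nhds hv) h)
  have h2 := (hp.dotProduct hp).unique h1
  rw [dotProduct_comm p'] at h2
  linarith

/-- The Frenet formula `t' = -r + κ n` of a unit speed spherical curve. -/
lemma hasDerivAt_sphT (hJ : IsOpen J) (hr : ContDiffOn ℝ (⊤ : ℕ∞) r J)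
    (hrs : ∀ v ∈ J, r v ⬝ᵥ r v = 1) (hra : ∀ v ∈ J, deriv r v ⬝ᵥ deriv r v = 1)
    {v : ℝ} (hv : v ∈ J) :
    HasDerivAt (deriv r) (-r v + sphCurv r v • sphN r v) v := by
  have hrt : ∀ w ∈ J, r w ⬝ᵥ deriv r w = 0 := fun w hw =>
    dotProduct_deriv_of_unit hJ hrs hw (hasDerivAt_deriv_of_contDiffOn hJ hr hw).1
  obtain ⟨h1, h2⟩ := hasDerivAt_deriv_of_contDiffOn hJ hr hv
  have h3 : HasDerivAt (fun s => r s ⬝ᵥ deriv r s) 0 v :=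
    (hasDerivAt_const v (0 : ℝ)).congr_of_eventuallyEq
      (Filter.eventually_of_mem (hJ.mem_nhds hv) hrt)
  have h4 := (h1.dotProduct h2).unique h3
  rw [hra v hv] at h4
  have h5 := eq_neg_add_smul_cross (hrs v hv) (hra v hv) (hrt v hv)
    (by linarith : r v ⬝ᵥ deriv (deriv r) v = -1) (dotProduct_deriv_of_unit hJ hra hv h2) rfl
  rw [h5] at h2
  exact h2

/-- The Frenet formula `n' = -κ t` of a unit speed spherical curve. -/
lemma hasDerivAt_sphN (hJ : IsOpen J) (hr : ContDiffOn ℝ (⊤ : ℕ∞) r J)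
    (hrs : ∀ v ∈ J, r v ⬝ᵥ r v = 1) (hra : ∀ v ∈ J, deriv r v ⬝ᵥ deriv r v = 1)
    {v : ℝ} (hv : v ∈ J) :
    HasDerivAt (sphN r) (-(sphCurv r v • deriv r v)) v := by
  have h1 := (hasDerivAt_deriv_of_contDiffOn hJ hr hv).1
  have hrt := dotProduct_deriv_of_unit hJ hrs hv h1
  have h := h1.crossProduct (hasDerivAt_sphT hJ hr hrs hra hv)
  have hrn : crossProduct (r v) (sphN r v) = -deriv r v := by
    have h : crossProduct (r v) (sphN r v)
        = (r v ⬝ᵥ deriv r v) • r v - (r v ⬝ᵥ r v) • deriv r v := by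
      ext i
      fin_cases i <;> simp [sphN, cross_apply, dotProduct, Fin.sum_univ_three] <;> ring
    rw [h, hrt, hrs v hv]; simp
  refine h.congr_deriv ?_
  rw [cross_self, map_add, map_neg, cross_self, map_smul, hrn]
  simp

lemma hasDerivAt_wedge_frame (hJ : IsOpen J) (hr : ContDiffOn ℝ (⊤ : ℕ∞) r J)
    (hrs : ∀ v ∈ J, r v ⬝ᵥ r v = 1) (hra : ∀ v ∈ J, deriv r v ⬝ᵥ deriv r v = 1)
    {κ₀ : ℝ} (hκ : ∀ v ∈ J, sphCurv r v = κ₀) {v : ℝ} (hv : v ∈ J) :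
    HasDerivAt (fun s => wedge (emb (r s)) (emb (deriv r s))
      + κ₀ • wedge (emb (deriv r s)) (emb (sphN r s))) 0 v := by
  have h0 := (hasDerivAt_deriv_of_contDiffOn hJ hr hv).1.emb
  have h1 := (hasDerivAt_sphT hJ hr hrs hra hv).emb
  have h2 := (hasDerivAt_sphN hJ hr hrs hra hv).emb
  rw [hκ v hv] at h1 h2
  refine ((h0.wedge h1).fun_add ((h1.wedge h2).fun_const_smul κ₀)).congr_deriv ?_
  ext i j
  simp only [emb_add, emb_neg, emb_smul, wedge, Pi.add_apply, Pi.neg_apply, Pi.smul_apply,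
    smul_eq_mul, Pi.zero_apply]
  ring

end SphericalCurve

lemma deriv_eq_of_eqOn_linear {I : Set ℝ} (hI : IsOpen I) {f : ℝ → ℝ} {a a₁ : ℝ}
    (h : ∀ u ∈ I, f u = a * u + a₁) {u : ℝ} (hu : u ∈ I) : deriv f u = a := by
  have h1 : HasDerivAt (fun s : ℝ => a * s + a₁) a u := by
    simpa using ((hasDerivAt_id u).const_mul a).add_const a₁
  exact (h1.congr_of_eventuallyEq (Filter.eventually_of_mem (hI.mem_nhds hu) h)).deriv

/-- For a linear meridian, `C` does not depend on the meridian parameter. -/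
lemma C15_eq {f g : ℝ → ℝ} {r : ℝ → Fin 3 → ℝ} {a b κ₀ u v : ℝ} (hab : a ^ 2 + b ^ 2 = 1)
    (hfu : deriv f u = a) (hgu : deriv g u = b) :
    C15 f g r a b κ₀ u v = (-(a / (1 + κ₀ ^ 2))) • (wedge (emb (r v)) (emb (deriv r v))
      + κ₀ • wedge (emb (deriv r v)) (emb (sphN r v))) := by
  unfold C15
  congr 1
  ext i j
  simp only [mx, my, mn1, mn2, hfu, hgu, wedge, Pi.add_apply, Pi.smul_apply, smul_eq_mul]
  linear_combination (emb (r v) i * emb (deriv r v) j - emb (r v) j * emb (deriv r v) i) * hab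

lemma wedge_frame_ne_zero {r : ℝ → Fin 3 → ℝ} {v κ : ℝ} (hrr : r v ⬝ᵥ r v = 1)
    (htt : deriv r v ⬝ᵥ deriv r v = 1) (hrt : r v ⬝ᵥ deriv r v = 0) :
    wedge (emb (r v)) (emb (deriv r v)) + κ • wedge (emb (deriv r v)) (emb (sphN r v)) ≠ 0 := by
  intro h
  have hnn : sphN r v ⬝ᵥ sphN r v = 1 := by
    rw [sphN, cross_dot_cross, hrr, htt, hrt, dotProduct_comm _ (r v), hrt]; ring
  have hdot : (sphN r v + κ • crossProduct (deriv r v) (sphN r v)) ⬝ᵥ sphN r v = 1 := by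
    rw [add_dotProduct, hnn, smul_dotProduct, dotProduct_comm, dot_cross_self]; simp
  have hzero : sphN r v + κ • crossProduct (deriv r v) (sphN r v) = 0 := by
    have h01 := congrFun (congrFun h 0) 1
    have h12 := congrFun (congrFun h 1) 2
    have h20 := congrFun (congrFun h 2) 0
    simp [wedge, emb] at h01 h12 h20
    generalize hn : sphN r v = n at *
    have hn' := hn.symm
    rw [sphN, cross_apply] at hn'
    ext i
    fin_cases i
    · have := congrFun hn' 0
      simp [cross_apply] at this ⊢; linarith
    · have := congrFun hn' 1
      simp [cross_apply] at this ⊢; linarith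
    · have := congrFun hn' 2
      simp [cross_apply] at this ⊢; linarith
  rw [hzero] at hdot
  simp at hdot

/-- The Laplacian of the Gauss map of a meridian surface with linear meridian curve over a
spherical curve of constant curvature. -/
lemma surfLap_gaussG_linear {I J : Set ℝ} (hI : IsOpen I) (hJ : IsOpen J)
    {r : ℝ → Fin 3 → ℝ} (hr : ContDiffOn ℝ (⊤ : ℕ∞) r J)
    (hrs : ∀ v ∈ J, r v ⬝ᵥ r v = 1) (hra : ∀ v ∈ J, deriv r v ⬝ᵥ deriv r v = 1)
    {f g : ℝ → ℝ} {a b κ₀ : ℝ} (hab : a ^ 2 + b ^ 2 = 1)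
    (hfu : ∀ u ∈ I, deriv f u = a) (hgu : ∀ u ∈ I, deriv g u = b)
    (hκ : ∀ v ∈ J, sphCurv r v = κ₀) {u v : ℝ} (hu : u ∈ I) (hv : v ∈ J) :
    surfLap f (gaussG f g r) u v
      = ((1 + κ₀ ^ 2) / f u ^ 2) • (gaussG f g r u v + C15 f g r a b κ₀ u v) := by
  have hdu : ∀ s ∈ I, deriv (fun s => gaussG f g r s v) s = 0 := by
    intro s hs
    have h : (fun s => gaussG f g r s v) =ᶠ[nhds s] fun _ => gaussG f g r u v := by
      filter_upwards [hI.mem_nhds hs] with w hw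
      simp only [gaussG, mx, hfu w hw, hgu w hw, hfu u hu, hgu u hu]
    rw [h.deriv_eq, deriv_const]
  have hduu : deriv (deriv (fun s => gaussG f g r s v)) u = 0 := by
    have h : deriv (fun s => gaussG f g r s v) =ᶠ[nhds u] fun _ => 0 :=
      Filter.eventually_of_mem (hI.mem_nhds hu) hdu
    rw [h.deriv_eq, deriv_const]
  have hr' : ∀ s ∈ J, HasDerivAt (fun s => emb (r s)) (emb (deriv r s)) s := fun s hs =>
    (hasDerivAt_deriv_of_contDiffOn hJ hr hs).1.emb
  have ht' : ∀ s ∈ J, HasDerivAt (fun s => emb (deriv r s)) (emb (-r s + κ₀ • sphN r s)) s :=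
    fun s hs => hκ s hs ▸ (hasDerivAt_sphT hJ hr hrs hra hs).emb
  have hn' : HasDerivAt (fun s => emb (sphN r s)) (emb (-(κ₀ • deriv r v))) v :=
    hκ v hv ▸ (hasDerivAt_sphN hJ hr hrs hra hv).emb
  have hx' : ∀ s ∈ J, HasDerivAt (fun s => mx f g r u s) (a • emb (deriv r s)) s := by
    intro s hs
    have h := ((hr' s hs).fun_const_smul (deriv f u)).add_const (deriv g u • e4)
    exact h.congr_deriv (by rw [hfu u hu])
  have hdv : deriv (fun s => gaussG f g r u s) =ᶠ[nhds v] fun s =>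
      wedge (mx f g r u s) (-emb (r s) + κ₀ • emb (sphN r s)) := by
    filter_upwards [hJ.mem_nhds hv] with s hs
    refine ((hx' s hs).wedge (ht' s hs)).deriv.trans ?_
    ext i j
    simp only [emb_add, emb_neg, emb_smul, wedge, Pi.add_apply, Pi.neg_apply, Pi.smul_apply,
      smul_eq_mul]
    ring
  have hdvv := hdv.deriv_eq.trans
    ((hx' v hv).wedge ((hr' v hv).neg.add (hn'.const_smul κ₀))).deriv
  have hk : (1 + κ₀ ^ 2 : ℝ) ≠ 0 := by positivity
  rw [C15_eq hab (hfu u hu) (hgu u hu), surfLap, hduu, hdu u hu, hdvv]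
  ext i j
  simp only [gaussG, mx, my, hfu u hu, hgu u hu, emb_neg, emb_smul, wedge, Pi.add_apply,
    Pi.neg_apply, Pi.smul_apply, smul_eq_mul, Pi.zero_apply]
  by_cases hf : f u = 0
  · simp [hf]
  field_simp
  ring

/-- If `f(u) = au + a₁`, `g(u) = bu + b₁` with `a² + b² = 1`, `a ≠ 0`,
`b ≠ 0`, and `κ ≡ κ₀`, then `ΔG = ((1 + κ₀²)/f²)(G + C)` with
`C = −(a/(1+κ₀²))(a x∧y + κ₀ y∧n₁ + b y∧n₂)` a nonzero bivector constant in `(u,v)`; in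
particular `M²` has pointwise 1-type Gauss map of the second kind. -/
theorem meridian_surface_second_kind_example_linear_meridian
    (I J : Set ℝ) (hI : IsOpen I) (hIiv : I.OrdConnected) (hIne : I.Nonempty)
    (hJ : IsOpen J) (hJiv : J.OrdConnected) (hJne : J.Nonempty)
    (r : ℝ → Fin 3 → ℝ) (hr : ContDiffOn ℝ (⊤ : ℕ∞) r J)
    (hrs : ∀ v ∈ J, r v ⬝ᵥ r v = 1) (hra : ∀ v ∈ J, deriv r v ⬝ᵥ deriv r v = 1)
    (f g : ℝ → ℝ) (hf : ContDiffOn ℝ (⊤ : ℕ∞) f I) (hg : ContDiffOn ℝ (⊤ : ℕ∞) g I)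
    (hf0 : ∀ u ∈ I, f u ≠ 0) (hfg : ∀ u ∈ I, deriv f u ^ 2 + deriv g u ^ 2 = 1)
    (a a₁ b b₁ κ₀ : ℝ) (hab : a ^ 2 + b ^ 2 = 1) (ha : a ≠ 0) (hb : b ≠ 0)
    (hfu : ∀ u ∈ I, f u = a * u + a₁) (hgu : ∀ u ∈ I, g u = b * u + b₁)
    (hκ : ∀ v ∈ J, sphCurv r v = κ₀) :
    (∀ u ∈ I, ∀ v ∈ J,
        surfLap f (gaussG f g r) u v
          = ((1 + κ₀ ^ 2) / f u ^ 2) • (gaussG f g r u v + C15 f g r a b κ₀ u v)) ∧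
    (∀ u ∈ I, ∀ v ∈ J, ∀ u' ∈ I, ∀ v' ∈ J, C15 f g r a b κ₀ u v = C15 f g r a b κ₀ u' v') ∧
    (∀ u ∈ I, ∀ v ∈ J, C15 f g r a b κ₀ u v ≠ 0) ∧
    (∃ (lam : ℝ → ℝ → ℝ) (C : Fin 4 → Fin 4 → ℝ),
        ContDiffOn ℝ (⊤ : ℕ∞) (Function.uncurry lam) (I ×ˢ J) ∧
        (∀ u ∈ I, ∀ v ∈ J, lam u v ≠ 0) ∧
        (∀ i j, C i j = -C j i) ∧ C ≠ 0 ∧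
        ∀ u ∈ I, ∀ v ∈ J, surfLap f (gaussG f g r) u v = lam u v • (gaussG f g r u v + C)) := by
  have hfd : ∀ u ∈ I, deriv f u = a := fun u hu => deriv_eq_of_eqOn_linear hI hfu hu
  have hgd : ∀ u ∈ I, deriv g u = b := fun u hu => deriv_eq_of_eqOn_linear hI hgu hu
  have hk : (1 + κ₀ ^ 2 : ℝ) ≠ 0 := by positivity
  have hlap : ∀ u ∈ I, ∀ v ∈ J, surfLap f (gaussG f g r) u v
      = ((1 + κ₀ ^ 2) / f u ^ 2) • (gaussG f g r u v + C15 f g r a b κ₀ u v) :=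
    fun u hu v hv => surfLap_gaussG_linear hI hJ hr hrs hra hab hfd hgd hκ hu hv
  have hconst : ∀ u ∈ I, ∀ v ∈ J, ∀ u' ∈ I, ∀ v' ∈ J,
      C15 f g r a b κ₀ u v = C15 f g r a b κ₀ u' v' := by
    intro u hu v hv u' hu' v' hv'
    rw [C15_eq hab (hfd u hu) (hgd u hu), C15_eq hab (hfd u' hu') (hgd u' hu')]
    have hd := fun s hs => hasDerivAt_wedge_frame hJ hr hrs hra hκ (v := s) hs
    congr 1
    exact hJ.is_const_of_deriv_eq_zero hJiv.isPreconnected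
      (fun s hs => (hd s hs).differentiableAt.differentiableWithinAt)
      (fun s hs => (hd s hs).deriv) hv hv'
  have hne : ∀ u ∈ I, ∀ v ∈ J, C15 f g r a b κ₀ u v ≠ 0 := by
    intro u hu v hv
    rw [C15_eq hab (hfd u hu) (hgd u hu)]
    exact smul_ne_zero (neg_ne_zero.2 (div_ne_zero ha hk))
      (wedge_frame_ne_zero (hrs v hv) (hra v hv) (dotProduct_deriv_of_unit hJ hrs hv
        (hasDerivAt_deriv_of_contDiffOn hJ hr hv).1))
  refine ⟨hlap, hconst, hne, ?_⟩
  obtain ⟨u₀, hu₀⟩ := hIne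
  obtain ⟨v₀, hv₀⟩ := hJne
  refine ⟨fun u _ => (1 + κ₀ ^ 2) / f u ^ 2, C15 f g r a b κ₀ u₀ v₀, ?_, ?_, ?_,
    hne u₀ hu₀ v₀ hv₀, ?_⟩
  · have hf' : ContDiffOn ℝ (⊤ : ℕ∞) (fun p : ℝ × ℝ => f p.1) (I ×ˢ J) :=
      hf.comp contDiff_fst.contDiffOn fun p hp => hp.1
    exact contDiffOn_const.div (hf'.pow 2) fun p hp => pow_ne_zero 2 (hf0 p.1 hp.1)
  · exact fun u hu _ _ => div_ne_zero hk (pow_ne_zero 2 (hf0 u hu))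
  · intro i j
    simp only [C15, wedge, Pi.add_apply, Pi.smul_apply, smul_eq_mul]
    ring
  · intro u hu v hv
    rw [hlap u hu v hv, hconst u hu v hv u₀ hu₀ v₀ hv₀]
end
end

section
/- Suppose g'(u) ≠ 0 for all u, κ ≡ 0 (the curve r is a great circle), the function λ := [g'(1 + (f κ_α)²) − f f'(f κ_α)'] / (f² g') is nowhere zero, and the function φ := −(f' g' − f (f κ_α)')/(λ f²) is nowhere zero. Then M² has pointwise 1-type Gauss map of the second kind (ΔG = λ(G + C) with this λ and a nonzero constant bivector C) if and only if (ln φ)' = (f'/g') κ_α on I, which for g' = √(1 − f'²) is equivalent to the equation (ln[ −√(1 − f'²)( f(1 − f'²)(f f'')' + f² f' f''² + f'(1 − f'²)² ) / ( f f'(f f'')'(1 − f'²) + f² f''² + (1 − f'²)² ) ])' = −f' f''/(1 − f'²); in this case C = φ·((f'/g') x∧y + y∧n₂). -/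
open Matrix

noncomputable section

/-- The function `λ = [g′(1 + (fκ_α)²) − f f′(fκ_α)′]/(f²g′)` of Statement 16. -/
def lam16 (f g : ℝ → ℝ) (u : ℝ) : ℝ :=
  (deriv g u * (1 + (f u * merCurv f g u) ^ 2)
    - f u * deriv f u * deriv (fun s => f s * merCurv f g s) u) / (f u ^ 2 * deriv g u)

/-- The function `φ = −(f′g′ − f(fκ_α)′)/(λf²)` of Statement 16. -/
def phi16 (f g : ℝ → ℝ) (u : ℝ) : ℝ :=
  -(deriv f u * deriv g u - f u * deriv (fun s => f s * merCurv f g s) u)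
    / (lam16 f g u * f u ^ 2)

/-- The bivector `C = φ((f′/g′) x∧y + y∧n₂)` of Statement 16. -/
def C16 (f g : ℝ → ℝ) (r : ℝ → Fin 3 → ℝ) (u v : ℝ) : Fin 4 → Fin 4 → ℝ :=
  phi16 f g u • ((deriv f u / deriv g u) • wedge (mx f g r u v) (my r v)
    + wedge (my r v) (mn2 f g r u v))

open scoped ContDiff

/-- The derivative of a smooth function on an open set is smooth. -/
theorem ContDiffOn.deriv_infty {E : Type*} [NormedAddCommGroup E] [NormedSpace ℝ E]
    {S : Set ℝ} (hS : IsOpen S) {h : ℝ → E} (hh : ContDiffOn ℝ ∞ h S) :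
    ContDiffOn ℝ ∞ (deriv h) S :=
  hh.deriv_of_isOpen hS (by simp)

theorem ContDiffOn.hasDerivAt_of_isOpen {E : Type*} [NormedAddCommGroup E] [NormedSpace ℝ E]
    {S : Set ℝ} (hS : IsOpen S) {h : ℝ → E} (hh : ContDiffOn ℝ ∞ h S) {x : ℝ} (hx : x ∈ S) :
    HasDerivAt h (deriv h x) x :=
  ((hh.differentiableOn (by simp)).differentiableAt (hS.mem_nhds hx)).hasDerivAt

theorem hasDerivAt_dotProduct {p q : ℝ → Fin 3 → ℝ} {p' q' : Fin 3 → ℝ} {x : ℝ}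
    (hp : HasDerivAt p p' x) (hq : HasDerivAt q q' x) :
    HasDerivAt (fun s => p s ⬝ᵥ q s) (p' ⬝ᵥ q x + p x ⬝ᵥ q') x := by
  rw [hasDerivAt_pi] at hp hq
  have h := HasDerivAt.fun_sum (u := Finset.univ) fun i _ => (hp i).fun_mul (hq i)
  simpa only [dotProduct, Finset.sum_add_distrib] using h

theorem hasDerivAt_emb {p : ℝ → Fin 3 → ℝ} {p' : Fin 3 → ℝ} {x : ℝ}
    (hp : HasDerivAt p p' x) : HasDerivAt (fun s => emb (p s)) (emb p') x := by
  rw [hasDerivAt_pi] at hp ⊢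
  intro i
  fin_cases i
  · exact hp 0
  · exact hp 1
  · exact hp 2
  · exact hasDerivAt_const x (0 : ℝ)

theorem hasDerivAt_wedge {p q : ℝ → Fin 4 → ℝ} {p' q' : Fin 4 → ℝ} {x : ℝ}
    (hp : HasDerivAt p p' x) (hq : HasDerivAt q q' x) :
    HasDerivAt (fun s => wedge (p s) (q s)) (wedge p' (q x) + wedge (p x) q') x := by
  rw [hasDerivAt_pi] at hp hq
  refine hasDerivAt_pi.2 fun i => hasDerivAt_pi.2 fun j => ?_
  refine (((hp i).fun_mul (hq j)).fun_sub ((hp j).fun_mul (hq i))).congr_deriv ?_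
  simp only [wedge, Pi.add_apply]
  ring

/-- A vector orthogonal to `a`, `b` and `a × b`, where `a`, `b` are orthonormal, vanishes. -/
theorem eq_zero_of_orthogonal_frame {a b w : Fin 3 → ℝ} (haa : a ⬝ᵥ a = 1) (hbb : b ⬝ᵥ b = 1)
    (hab : a ⬝ᵥ b = 0) (hwa : w ⬝ᵥ a = 0) (hwb : w ⬝ᵥ b = 0)
    (hwn : w ⬝ᵥ crossProduct a b = 0) : w = 0 := by
  have gram : (w ⬝ᵥ crossProduct a b) ^ 2 =
      (w ⬝ᵥ w) * ((a ⬝ᵥ a) * (b ⬝ᵥ b) - (a ⬝ᵥ b) ^ 2)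
        - (w ⬝ᵥ a) * ((w ⬝ᵥ a) * (b ⬝ᵥ b) - (a ⬝ᵥ b) * (w ⬝ᵥ b))
        + (w ⬝ᵥ b) * ((w ⬝ᵥ a) * (a ⬝ᵥ b) - (a ⬝ᵥ a) * (w ⬝ᵥ b)) := by
    simp only [cross_apply, dotProduct, Fin.sum_univ_three, cons_val]
    ring
  rw [haa, hbb, hab, hwa, hwb, hwn] at gram
  exact dotProduct_self_eq_zero.1 (by linarith)

section SphericalCurve

variable {J : Set ℝ} {r : ℝ → Fin 3 → ℝ}

theorem dotProduct_deriv_eq_zero (hJ : IsOpen J) {p : ℝ → Fin 3 → ℝ}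
    (hp : ContDiffOn ℝ ∞ p J) (hps : ∀ v ∈ J, p v ⬝ᵥ p v = 1) {v : ℝ} (hv : v ∈ J) :
    p v ⬝ᵥ deriv p v = 0 := by
  have hd := hp.hasDerivAt_of_isOpen hJ hv
  have h0 : HasDerivAt (fun s => p s ⬝ᵥ p s) 0 v :=
    (hasDerivAt_const v (1 : ℝ)).congr_of_eventuallyEq
      (Filter.eventually_of_mem (hJ.mem_nhds hv) hps)
  have h := (hasDerivAt_dotProduct hd hd).unique h0
  rw [dotProduct_comm (deriv p v)] at h
  linarith

/-- A unit speed spherical curve of vanishing spherical curvature satisfies `r'' = -r`. -/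
theorem deriv_deriv_eq_neg (hJ : IsOpen J) (hr : ContDiffOn ℝ ∞ r J)
    (hrs : ∀ v ∈ J, r v ⬝ᵥ r v = 1) (hra : ∀ v ∈ J, deriv r v ⬝ᵥ deriv r v = 1)
    (hκ : ∀ v ∈ J, sphCurv r v = 0) {v : ℝ} (hv : v ∈ J) :
    deriv (deriv r) v = -r v := by
  have hr' := hr.deriv_infty hJ
  have hrt := dotProduct_deriv_eq_zero hJ hr hrs hv
  have htt := dotProduct_deriv_eq_zero hJ hr' hra hv
  have h0 : HasDerivAt (fun s => r s ⬝ᵥ deriv r s) 0 v :=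
    (hasDerivAt_const v (0 : ℝ)).congr_of_eventuallyEq
      (Filter.eventually_of_mem (hJ.mem_nhds hv)
        fun s hs => dotProduct_deriv_eq_zero hJ hr hrs hs)
  have h := (hasDerivAt_dotProduct (hr.hasDerivAt_of_isOpen hJ hv)
    (hr'.hasDerivAt_of_isOpen hJ hv)).unique h0
  refine eq_neg_of_add_eq_zero_left
    (eq_zero_of_orthogonal_frame (hrs v hv) (hra v hv) hrt ?_ ?_ ?_)
  · rw [add_dotProduct, dotProduct_comm, hrs v hv]
    linarith [hra v hv]
  · rw [add_dotProduct, dotProduct_comm, htt, hrt, add_zero]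
  · rw [add_dotProduct, dot_self_cross, add_zero]
    exact hκ v hv

/-- The bivector `r ∧ t` spanning the plane of a great circle. -/
def planeBivector (r : ℝ → Fin 3 → ℝ) (v : ℝ) : Fin 4 → Fin 4 → ℝ :=
  wedge (emb (r v)) (emb (deriv r v))

/-- The bivector `e₄ ∧ t`. -/
def axisBivector (r : ℝ → Fin 3 → ℝ) (v : ℝ) : Fin 4 → Fin 4 → ℝ :=
  wedge e4 (emb (deriv r v))

theorem planeBivector_ne_zero {v : ℝ} (hs : r v ⬝ᵥ r v = 1) (ha : deriv r v ⬝ᵥ deriv r v = 1)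
    (hrt : r v ⬝ᵥ deriv r v = 0) : planeBivector r v ≠ 0 := by
  intro h
  have entry (i j : Fin 4) : planeBivector r v i j = 0 := by rw [h]; rfl
  have h01 := entry 0 1
  have h02 := entry 0 2
  have h12 := entry 1 2
  simp only [planeBivector, wedge, emb, cons_val] at h01 h02 h12
  simp only [dotProduct, Fin.sum_univ_three] at hs ha hrt
  generalize r v = p at *
  generalize deriv r v = q at *
  have lagrange : (p 0 * p 0 + p 1 * p 1 + p 2 * p 2) * (q 0 * q 0 + q 1 * q 1 + q 2 * q 2)
      - (p 0 * q 0 + p 1 * q 1 + p 2 * q 2) ^ 2 =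
      (p 0 * q 1 - p 1 * q 0) ^ 2 + (p 0 * q 2 - p 2 * q 0) ^ 2
        + (p 1 * q 2 - p 2 * q 1) ^ 2 := by ring
  rw [hs, ha, hrt, h01, h02, h12] at lagrange
  norm_num at lagrange

theorem hasDerivAt_planeBivector {v : ℝ} (hr : HasDerivAt r (deriv r v) v)
    (ht : HasDerivAt (deriv r) (-r v) v) : HasDerivAt (planeBivector r) 0 v := by
  refine (hasDerivAt_wedge (hasDerivAt_emb hr) (hasDerivAt_emb ht)).congr_deriv ?_
  ext i j
  fin_cases i <;> fin_cases j <;> simp [wedge, emb] <;> ring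

theorem hasDerivAt_axisBivector {v : ℝ} (ht : HasDerivAt (deriv r) (-r v) v) :
    HasDerivAt (axisBivector r) (-wedge e4 (emb (r v))) v := by
  refine (hasDerivAt_wedge (hasDerivAt_const v e4) (hasDerivAt_emb ht)).congr_deriv ?_
  ext i j
  fin_cases i <;> fin_cases j <;> simp [wedge, emb, e4]

theorem hasDerivAt_neg_wedge_e4 {v : ℝ} (hr : HasDerivAt r (deriv r v) v) :
    HasDerivAt (fun s => -wedge e4 (emb (r s))) (-axisBivector r v) v := by
  refine (hasDerivAt_wedge (hasDerivAt_const v e4) (hasDerivAt_emb hr)).neg.congr_deriv ?_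
  ext i j
  fin_cases i <;> fin_cases j <;> simp [axisBivector, wedge, emb, e4]

theorem gaussG_eq (f g : ℝ → ℝ) (u v : ℝ) :
    gaussG f g r u v = deriv f u • planeBivector r v + deriv g u • axisBivector r v := by
  ext i j
  simp only [gaussG, mx, my, planeBivector, axisBivector, wedge, Pi.add_apply, Pi.smul_apply,
    smul_eq_mul]
  ring

theorem C16_eq {f g : ℝ → ℝ} {u : ℝ} (hfg : deriv f u ^ 2 + deriv g u ^ 2 = 1)
    (hg' : deriv g u ≠ 0) (v : ℝ) :
    C16 f g r u v = (phi16 f g u / deriv g u) • planeBivector r v := by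
  ext i j
  simp only [C16, mx, my, mn2, planeBivector, wedge, Pi.add_apply, Pi.smul_apply, smul_eq_mul]
  field_simp
  linear_combination phi16 f g u *
    (emb (r v) i * emb (deriv r v) j - emb (r v) j * emb (deriv r v) i) * hfg

end SphericalCurve

section Meridian

variable {I : Set ℝ} {f g : ℝ → ℝ}

theorem merCurv_contDiffOn (hI : IsOpen I) (hf : ContDiffOn ℝ ∞ f I) (hg : ContDiffOn ℝ ∞ g I) :
    ContDiffOn ℝ ∞ (merCurv f g) I :=
  ((hf.deriv_infty hI).mul ((hg.deriv_infty hI).deriv_infty hI)).sub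
    ((hg.deriv_infty hI).mul ((hf.deriv_infty hI).deriv_infty hI))

theorem phi16_contDiffOn (hI : IsOpen I) (hf : ContDiffOn ℝ ∞ f I) (hg : ContDiffOn ℝ ∞ g I)
    (hf0 : ∀ u ∈ I, f u ≠ 0) (hg' : ∀ u ∈ I, deriv g u ≠ 0)
    (hlam0 : ∀ u ∈ I, lam16 f g u ≠ 0) : ContDiffOn ℝ ∞ (phi16 f g) I := by
  have hk := hf.mul (merCurv_contDiffOn hI hf hg)
  have hm := hk.deriv_infty hI
  have ha := hf.deriv_infty hI
  have hb := hg.deriv_infty hI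
  have hlam : ContDiffOn ℝ ∞ (lam16 f g) I :=
    ((hb.mul (contDiffOn_const.add (hk.pow 2))).sub ((hf.mul ha).mul hm)).div
      ((hf.pow 2).mul hb) fun u hu => mul_ne_zero (pow_ne_zero 2 (hf0 u hu)) (hg' u hu)
  exact ((ha.mul hb).sub (hf.mul hm)).neg.div (hlam.mul (hf.pow 2))
    fun u hu => mul_ne_zero (hlam0 u hu) (pow_ne_zero 2 (hf0 u hu))

/-- The Frenet equations of the unit speed meridian curve. -/
theorem hasDerivAt_deriv_meridian (hI : IsOpen I) (hf : ContDiffOn ℝ ∞ f I)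
    (hg : ContDiffOn ℝ ∞ g I) (hfg : ∀ u ∈ I, deriv f u ^ 2 + deriv g u ^ 2 = 1)
    {u : ℝ} (hu : u ∈ I) :
    HasDerivAt (deriv f) (-(merCurv f g u * deriv g u)) u ∧
      HasDerivAt (deriv g) (merCurv f g u * deriv f u) u := by
  have ha := (hf.deriv_infty hI).hasDerivAt_of_isOpen hI hu
  have hb := (hg.deriv_infty hI).hasDerivAt_of_isOpen hI hu
  have h0 : HasDerivAt (fun s => deriv f s ^ 2 + deriv g s ^ 2) 0 u :=
    (hasDerivAt_const u (1 : ℝ)).congr_of_eventuallyEq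
      (Filter.eventually_of_mem (hI.mem_nhds hu) hfg)
  have h := ((ha.fun_pow 2).fun_add (hb.fun_pow 2)).unique h0
  norm_num at h
  have h1 := hfg u hu
  refine ⟨ha.congr_deriv ?_, hb.congr_deriv ?_⟩
  · simp only [merCurv]
    linear_combination (-deriv (deriv f) u) * h1 + deriv f u / 2 * h
  · simp only [merCurv]
    linear_combination (-deriv (deriv g) u) * h1 + deriv g u / 2 * h

/-- The condition `(ln φ)' = (f'/g') κ_α` says that `φ / g'` is stationary. -/
theorem deriv_log_phi16_iff (hI : IsOpen I) (hf : ContDiffOn ℝ ∞ f I)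
    (hg : ContDiffOn ℝ ∞ g I) (hf0 : ∀ u ∈ I, f u ≠ 0)
    (hfg : ∀ u ∈ I, deriv f u ^ 2 + deriv g u ^ 2 = 1) (hg' : ∀ u ∈ I, deriv g u ≠ 0)
    (hlam0 : ∀ u ∈ I, lam16 f g u ≠ 0) (hphi0 : ∀ u ∈ I, phi16 f g u ≠ 0)
    {u : ℝ} (hu : u ∈ I) :
    deriv (fun s => Real.log (phi16 f g s)) u = deriv f u / deriv g u * merCurv f g u ↔
      HasDerivAt (fun s => phi16 f g s / deriv g s) 0 u := by
  have hφ := (phi16_contDiffOn hI hf hg hf0 hg' hlam0).hasDerivAt_of_isOpen hI hu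
  have hb := (hasDerivAt_deriv_meridian hI hf hg hfg hu).2
  have hq := hφ.fun_div hb (hg' u hu)
  have hφ0 := hphi0 u hu
  have hb0 := hg' u hu
  rw [(hφ.log hφ0).deriv]
  constructor
  · intro h
    refine hq.congr_deriv ?_
    field_simp at h ⊢
    linear_combination h
  · intro h
    have := hq.unique h
    field_simp at this ⊢
    linear_combination this

end Meridian

/-- For a great circle `r`, `ΔG = λ (G + (φ / g') r ∧ t)`. -/
theorem surfLap_gaussG {I J : Set ℝ} (hI : IsOpen I) (hJ : IsOpen J) {r : ℝ → Fin 3 → ℝ}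
    (hr : ContDiffOn ℝ ∞ r J) (hrr : ∀ v ∈ J, deriv (deriv r) v = -r v)
    {f g : ℝ → ℝ} (hf : ContDiffOn ℝ ∞ f I) (hg : ContDiffOn ℝ ∞ g I)
    (hf0 : ∀ u ∈ I, f u ≠ 0) (hfg : ∀ u ∈ I, deriv f u ^ 2 + deriv g u ^ 2 = 1)
    (hg' : ∀ u ∈ I, deriv g u ≠ 0) (hlam0 : ∀ u ∈ I, lam16 f g u ≠ 0)
    {u v : ℝ} (hu : u ∈ I) (hv : v ∈ J) :
    surfLap f (gaussG f g r) u v =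
      lam16 f g u • (gaussG f g r u v + (phi16 f g u / deriv g u) • planeBivector r v) := by
  have ht (s : ℝ) (hs : s ∈ J) : HasDerivAt (deriv r) (-r s) s :=
    hrr s hs ▸ (hr.deriv_infty hJ).hasDerivAt_of_isOpen hJ hs
  have hr1 (s : ℝ) (hs : s ∈ J) := hr.hasDerivAt_of_isOpen hJ hs
  have hk := (merCurv_contDiffOn hI hf hg).hasDerivAt_of_isOpen hI hu
  have hfk := ((hf.hasDerivAt_of_isOpen hI hu).fun_mul hk).deriv
  obtain ⟨ha, hb⟩ := hasDerivAt_deriv_meridian hI hf hg hfg hu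
  have hGu (s : ℝ) (hs : s ∈ I) : deriv (fun s => gaussG f g r s v) s =
      (-(merCurv f g s * deriv g s)) • planeBivector r v
        + (merCurv f g s * deriv f s) • axisBivector r v := by
    obtain ⟨ha, hb⟩ := hasDerivAt_deriv_meridian hI hf hg hfg hs
    simp only [gaussG_eq]
    exact ((ha.smul_const _).fun_add (hb.smul_const _)).deriv
  have hGuu := (((hk.fun_mul hb).fun_neg.smul_const (planeBivector r v)).fun_add
    ((hk.fun_mul ha).smul_const (axisBivector r v))).congr_of_eventuallyEq
      (Filter.eventually_of_mem (hI.mem_nhds hu) hGu)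
  have hGv (s : ℝ) (hs : s ∈ J) : deriv (fun s => gaussG f g r u s) s =
      deriv g u • -wedge e4 (emb (r s)) := by
    simp only [gaussG_eq]
    refine (((hasDerivAt_planeBivector (hr1 s hs) (ht s hs)).fun_const_smul (deriv f u)).fun_add
      ((hasDerivAt_axisBivector (ht s hs)).fun_const_smul (deriv g u))).deriv.trans ?_
    rw [smul_zero, zero_add]
  have hGvv := ((hasDerivAt_neg_wedge_e4 (hr1 v hv)).fun_const_smul
    (deriv g u)).congr_of_eventuallyEq (Filter.eventually_of_mem (hJ.mem_nhds hv) hGv)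
  have hL : lam16 f g u * (f u ^ 2 * deriv g u) =
      deriv g u * (1 + (f u * merCurv f g u) ^ 2)
        - f u * deriv f u * (deriv f u * merCurv f g u + f u * deriv (merCurv f g) u) := by
    rw [← hfk, lam16]
    exact div_mul_cancel₀ _ (mul_ne_zero (pow_ne_zero 2 (hf0 u hu)) (hg' u hu))
  have hP : phi16 f g u * (lam16 f g u * f u ^ 2) =
      -(deriv f u * deriv g u
        - f u * (deriv f u * merCurv f g u + f u * deriv (merCurv f g) u)) := by
    rw [← hfk, phi16]
    exact div_mul_cancel₀ _ (mul_ne_zero (hlam0 u hu) (pow_ne_zero 2 (hf0 u hu)))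
  have h1 := hfg u hu
  have hf0 := hf0 u hu
  have hg' := hg' u hu
  rw [surfLap, hGuu.deriv, hGvv.deriv, hGu u hu, gaussG_eq]
  generalize planeBivector r v = R, axisBivector r v = E, lam16 f g u = L, phi16 f g u = P,
    deriv (merCurv f g) u = k', merCurv f g u = k, deriv f u = a, deriv g u = b, f u = c at *
  have hE : b * k ^ 2 - a * k' + b / c ^ 2 - a ^ 2 / c * k = L * b := by
    field_simp
    linear_combination -hL
  have hR : a * k ^ 2 + b * k' + a / c * b * k = L * (a + P / b) := by
    field_simp
    refine mul_left_cancel₀ hf0 ?_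
    linear_combination (-a) * hL - hP + (c * a * k + c ^ 2 * k') * h1
  ext i j
  simp only [Pi.add_apply, Pi.neg_apply, Pi.smul_apply, smul_eq_mul]
  linear_combination R i j * hR + E i j * hE

/-- A function with vanishing derivative on an open interval is constant there. -/
theorem eqOn_const_of_hasDerivAt_zero {E : Type*} [NormedAddCommGroup E] [NormedSpace ℝ E]
    {S : Set ℝ} (hS : IsOpen S) (hSiv : S.OrdConnected) {h : ℝ → E}
    (hh : ∀ x ∈ S, HasDerivAt h 0 x) {x y : ℝ} (hx : x ∈ S) (hy : y ∈ S) : h x = h y :=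
  hS.is_const_of_deriv_eq_zero hSiv.isPreconnected
    (fun z hz => (hh z hz).differentiableAt.differentiableWithinAt)
    (fun z hz => (hh z hz).deriv) hx hy

/-- For `g′ ≠ 0` everywhere and `κ ≡ 0`, with
`λ = [g′(1 + (fκ_α)²) − ff′(fκ_α)′]/(f²g′)` and `φ = −(f′g′ − f(fκ_α)′)/(λf²)` both
nowhere zero: `M²` has pointwise 1-type Gauss map of the second kind, `ΔG = λ(G + C)` with
this `λ` and a nonzero constant bivector `C`, iff `(ln φ)′ = (f′/g′)κ_α` on `I`; in this
case `C = φ((f′/g′) x∧y + y∧n₂)`. -/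
theorem meridian_surface_second_kind_iff_great_circle
    (I J : Set ℝ) (hI : IsOpen I) (hIiv : I.OrdConnected) (hIne : I.Nonempty)
    (hJ : IsOpen J) (hJiv : J.OrdConnected) (hJne : J.Nonempty)
    (r : ℝ → Fin 3 → ℝ) (hr : ContDiffOn ℝ (⊤ : ℕ∞) r J)
    (hrs : ∀ v ∈ J, r v ⬝ᵥ r v = 1) (hra : ∀ v ∈ J, deriv r v ⬝ᵥ deriv r v = 1)
    (f g : ℝ → ℝ) (hf : ContDiffOn ℝ (⊤ : ℕ∞) f I) (hg : ContDiffOn ℝ (⊤ : ℕ∞) g I)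
    (hf0 : ∀ u ∈ I, f u ≠ 0) (hfg : ∀ u ∈ I, deriv f u ^ 2 + deriv g u ^ 2 = 1)
    (hg' : ∀ u ∈ I, deriv g u ≠ 0) (hκ : ∀ v ∈ J, sphCurv r v = 0)
    (hlam0 : ∀ u ∈ I, lam16 f g u ≠ 0) (hphi0 : ∀ u ∈ I, phi16 f g u ≠ 0) :
    ((∃ C : Fin 4 → Fin 4 → ℝ, (∀ i j, C i j = -C j i) ∧ C ≠ 0 ∧
        ∀ u ∈ I, ∀ v ∈ J,
          surfLap f (gaussG f g r) u v = lam16 f g u • (gaussG f g r u v + C)) ↔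
      ∀ u ∈ I, deriv (fun s => Real.log (phi16 f g s)) u
        = deriv f u / deriv g u * merCurv f g u) ∧
    ((∀ u ∈ I, deriv (fun s => Real.log (phi16 f g s)) u
        = deriv f u / deriv g u * merCurv f g u) →
      (∀ u ∈ I, ∀ v ∈ J,
        surfLap f (gaussG f g r) u v = lam16 f g u • (gaussG f g r u v + C16 f g r u v)) ∧
      (∀ u ∈ I, ∀ v ∈ J, ∀ u' ∈ I, ∀ v' ∈ J, C16 f g r u v = C16 f g r u' v')) := by
  have hrr (v : ℝ) (hv : v ∈ J) := deriv_deriv_eq_neg hJ hr hrs hra hκ hv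
  have hlap (u : ℝ) (hu : u ∈ I) (v : ℝ) (hv : v ∈ J) :=
    surfLap_gaussG hI hJ hr hrr hf hg hf0 hfg hg' hlam0 hu hv
  have hlog (u : ℝ) (hu : u ∈ I) :=
    deriv_log_phi16_iff hI hf hg hf0 hfg hg' hlam0 hphi0 hu
  have hR0 (v : ℝ) (hv : v ∈ J) : planeBivector r v ≠ 0 :=
    planeBivector_ne_zero (hrs v hv) (hra v hv) (dotProduct_deriv_eq_zero hJ hr hrs hv)
  have hRconst (v : ℝ) (hv : v ∈ J) (v' : ℝ) (hv' : v' ∈ J) :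
      planeBivector r v = planeBivector r v' := by
    refine eqOn_const_of_hasDerivAt_zero hJ hJiv (fun s hs => ?_) hv hv'
    exact hasDerivAt_planeBivector (hr.hasDerivAt_of_isOpen hJ hs)
      (hrr s hs ▸ (hr.deriv_infty hJ).hasDerivAt_of_isOpen hJ hs)
  have hsuff (hode : ∀ u ∈ I, deriv (fun s => Real.log (phi16 f g s)) u
        = deriv f u / deriv g u * merCurv f g u) :
      (∀ u ∈ I, ∀ v ∈ J,
        surfLap f (gaussG f g r) u v = lam16 f g u • (gaussG f g r u v + C16 f g r u v)) ∧
      (∀ u ∈ I, ∀ v ∈ J, ∀ u' ∈ I, ∀ v' ∈ J, C16 f g r u v = C16 f g r u' v') := by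
    refine ⟨fun u hu v hv => ?_, fun u hu v hv u' hu' v' hv' => ?_⟩
    · rw [C16_eq (hfg u hu) (hg' u hu), hlap u hu v hv]
    · rw [C16_eq (hfg u hu) (hg' u hu), C16_eq (hfg u' hu') (hg' u' hu'),
        hRconst v hv v' hv']
      exact congrArg (· • planeBivector r v') (eqOn_const_of_hasDerivAt_zero hI hIiv
        (fun s hs => (hlog s hs).1 (hode s hs)) hu hu')
  obtain ⟨u₀, hu₀⟩ := hIne
  obtain ⟨v₀, hv₀⟩ := hJne
  refine ⟨⟨?_, fun hode => ?_⟩, hsuff⟩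
  · rintro ⟨C, -, -, hC⟩
    have hCeq (u : ℝ) (hu : u ∈ I) : (phi16 f g u / deriv g u) • planeBivector r v₀ = C :=
      add_left_cancel (smul_right_injective _ (hlam0 u hu)
        ((hlap u hu v₀ hv₀).symm.trans (hC u hu v₀ hv₀)))
    intro u hu
    refine (hlog u hu).2 ((hasDerivAt_const u (phi16 f g u / deriv g u)).congr_of_eventuallyEq
      (Filter.eventually_of_mem (hI.mem_nhds hu) fun s hs => ?_))
    exact smul_left_injective ℝ (hR0 v₀ hv₀) ((hCeq s hs).trans (hCeq u hu).symm)
  · obtain ⟨hΔ, hconst⟩ := hsuff hode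
    refine ⟨C16 f g r u₀ v₀, fun i j => ?_, ?_, fun u hu v hv => ?_⟩
    · simp only [C16, wedge, Pi.add_apply, Pi.smul_apply, smul_eq_mul]
      ring
    · rw [C16_eq (hfg u₀ hu₀) (hg' u₀ hu₀)]
      exact smul_ne_zero (div_ne_zero (hphi0 u₀ hu₀) (hg' u₀ hu₀)) (hR0 v₀ hv₀)
    · rw [hΔ u hu v hv, hconst u hu v hv u₀ hu₀ v₀ hv₀]
end
end
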